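/- arXiv:2002.10684 — 2 statements merged into one kernel-verified Lean document; each statement's English description precedes it below -/
import Mathlib

section
/- Let a = (a_1,…,a_n) be positive integers and let α'_0 = 1, α'_1, …, α'_{μ(a)} be the coefficients of the polynomial P_a(t) = ∏_{i=0}^{n}(1 − t^{r_i})^{(−1)^{i+n}}. Then α'_{μ(a)−j} = (−1)^{n−1}·α'_j for every 0 ≤ j ≤ μ(a); equivalently, t^{μ(a)}·P_a(1/t) = (−1)^{n−1}·P_a(t), i.e. the reversed polynomial of P_a equals (−1)^{n−1}·P_a. In particular the leading coefficient of P_a is α'_{μ(a)} = (−1)^{n−1}. -/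
/-- The Milnor number of the chain type singularity associated to the tuple
`a = (a_1, …, a_n)`, with `μ(∅) = 1`. -/
def chainMu (a : List ℕ) : ℤ :=
  ∑ k ∈ Finset.range (a.length + 1), (-1 : ℤ) ^ k * ((a.drop k).prod : ℤ)

/-- `r_i = a_{n−i+1} ⋯ a_n`, the product of the last `i` entries of `a`. -/
def chainR (a : List ℕ) (i : ℕ) : ℕ := (a.drop (a.length - i)).prod

open Polynomial in
lemma natDegree_one_sub_X_pow (k : ℕ) : (1 - X ^ k : ℤ[X]).natDegree = k := by
  rw [natDegree_sub, ← C_1, natDegree_X_pow_sub_C]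

open Polynomial in
lemma one_sub_X_pow_ne_zero {k : ℕ} (hk : 0 < k) : (1 - X ^ k : ℤ[X]) ≠ 0 := by
  intro h
  have := natDegree_one_sub_X_pow k
  rw [h, natDegree_zero] at this
  omega

open Polynomial in
lemma reverse_one_sub_X_pow (k : ℕ) : (1 - X ^ k : ℤ[X]).reverse = -(1 - X ^ k) := by
  have h : (1 - X ^ k : ℤ[X]) = C 1 * X ^ 0 + C (-1) * X ^ k := by
    simp [sub_eq_add_neg]
  rw [reverse, natDegree_one_sub_X_pow, h, reflect_add, reflect_C_mul_X_pow,
    reflect_C_mul_X_pow, revAt_le (Nat.zero_le k), revAt_le le_rfl]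
  simp

open Polynomial in
lemma prod_one_sub_X_pow_ne_zero {ι : Type*} (s : Finset ι) (f : ι → ℕ)
    (hf : ∀ i ∈ s, 0 < f i) : (∏ i ∈ s, (1 - X ^ f i : ℤ[X])) ≠ 0 :=
  Finset.prod_ne_zero_iff.2 fun i hi => one_sub_X_pow_ne_zero (hf i hi)

open Polynomial in
lemma natDegree_prod_one_sub_X_pow {ι : Type*} (s : Finset ι) (f : ι → ℕ)
    (hf : ∀ i ∈ s, 0 < f i) :
    (∏ i ∈ s, (1 - X ^ f i : ℤ[X])).natDegree = ∑ i ∈ s, f i := by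
  rw [natDegree_prod _ _ fun i hi => one_sub_X_pow_ne_zero (hf i hi)]
  simp only [natDegree_one_sub_X_pow]

open Polynomial in
lemma reverse_prod_one_sub_X_pow {ι : Type*} (s : Finset ι) (f : ι → ℕ) :
    (∏ i ∈ s, (1 - X ^ f i : ℤ[X])).reverse =
      (-1) ^ s.card * ∏ i ∈ s, (1 - X ^ f i : ℤ[X]) := by
  classical
  induction s using Finset.induction_on with
  | empty => simpa using reverse_C (1 : ℤ)
  | insert i s hi ih =>
    rw [Finset.prod_insert hi, reverse_mul_of_domain, ih, reverse_one_sub_X_pow,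
      Finset.card_insert_of_notMem hi]
    ring

open Polynomial in
lemma coeff_zero_prod_one_sub_X_pow {ι : Type*} (s : Finset ι) (f : ι → ℕ)
    (hf : ∀ i ∈ s, 0 < f i) : (∏ i ∈ s, (1 - X ^ f i : ℤ[X])).coeff 0 = 1 := by
  rw [coeff_zero_prod]
  refine Finset.prod_eq_one fun i hi => ?_
  simp [coeff_X_pow, (hf i hi).ne]

lemma chainR_pos {a : List ℕ} (hpos : ∀ x ∈ a, 0 < x) (i : ℕ) : 0 < chainR a i :=
  List.prod_pos fun x hx => hpos x (List.mem_of_mem_drop hx)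

lemma chainMu_eq_sum_chainR (a : List ℕ) :
    chainMu a = ∑ i ∈ (Finset.range (a.length + 1)).filter (fun i => i % 2 = a.length % 2),
        (chainR a i : ℤ) -
      ∑ i ∈ (Finset.range (a.length + 1)).filter (fun i => ¬ i % 2 = a.length % 2),
        (chainR a i : ℤ) := by
  rw [chainMu, ← Finset.sum_range_reflect, Finset.sum_filter, Finset.sum_filter,
    ← Finset.sum_sub_distrib]
  refine Finset.sum_congr rfl fun i hi => ?_
  have hi : i ≤ a.length := Nat.lt_succ_iff.1 (Finset.mem_range.1 hi)
  rw [show a.length + 1 - 1 - i = a.length - i by omega, chainR]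
  by_cases h : i % 2 = a.length % 2
  · rw [Even.neg_one_pow (Nat.even_iff.2 (by omega))]
    simp [h]
  · rw [Odd.neg_one_pow (Nat.odd_iff.2 (by omega))]
    simp [h]

/-- Let `P = P_a` be the polynomial `∏_{i=0}^{n} (1 − t^{r_i})^{(−1)^{i+n}}`
(characterized by `∏_{i ≡ n (2)} (1 − t^{r_i}) = P ⋅ ∏_{i ≢ n (2)} (1 − t^{r_i})`),
whose coefficients are `α'_0 = 1, α'_1, …, α'_{μ(a)}`.  Then
`α'_{μ(a)−j} = (−1)^{n−1} α'_j` for all `0 ≤ j ≤ μ(a)`; in particular the leading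
coefficient is `α'_{μ(a)} = (−1)^{n−1}`. -/
theorem stmt4 (a : List ℕ) (hne : a ≠ []) (hpos : ∀ x ∈ a, 0 < x)
    (m : ℕ) (hm : (m : ℤ) = chainMu a)
    (P : Polynomial ℤ)
    (hP : (∏ i ∈ (Finset.range (a.length + 1)).filter (fun i => i % 2 = a.length % 2),
          (1 - (Polynomial.X : Polynomial ℤ) ^ chainR a i)) =
        P * ∏ i ∈ (Finset.range (a.length + 1)).filter (fun i => ¬ i % 2 = a.length % 2),
          (1 - (Polynomial.X : Polynomial ℤ) ^ chainR a i)) :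
    (∀ j : ℕ, j ≤ m → P.coeff (m - j) = (-1 : ℤ) ^ (a.length - 1) * P.coeff j) ∧
      P.coeff m = (-1 : ℤ) ^ (a.length - 1) := by
  have hr : ∀ i, 0 < chainR a i := chainR_pos hpos
  have hmu := hm.trans (chainMu_eq_sum_chainR a)
  have hcard := Finset.card_filter_add_card_filter_not (s := Finset.range (a.length + 1))
    (fun i => i % 2 = a.length % 2)
  rw [Finset.card_range] at hcard
  generalize (Finset.range (a.length + 1)).filter (fun i => i % 2 = a.length % 2) = s at *
  generalize (Finset.range (a.length + 1)).filter (fun i => ¬ i % 2 = a.length % 2) = t at *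
  have hs := prod_one_sub_X_pow_ne_zero s (chainR a) fun i _ => hr i
  have ht := prod_one_sub_X_pow_ne_zero t (chainR a) fun i _ => hr i
  have hP0 : P ≠ 0 := by
    rintro rfl
    exact hs (by rw [hP, zero_mul])
  have hdeg : P.natDegree = m := by
    have h := congrArg Polynomial.natDegree hP
    rw [Polynomial.natDegree_mul hP0 ht, natDegree_prod_one_sub_X_pow s _ fun i _ => hr i,
      natDegree_prod_one_sub_X_pow t _ fun i _ => hr i] at h
    zify at h
    linarith
  have hsign : (-1 : Polynomial ℤ) ^ s.card = (-1) ^ (a.length - 1) * (-1) ^ t.card := by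
    have hlen := List.length_pos_iff.2 hne
    rw [← pow_add, neg_one_pow_eq_pow_mod_two, neg_one_pow_eq_pow_mod_two (n := _ + _)]
    congr 1
    omega
  have hrev : P.reverse = (-1) ^ (a.length - 1) * P := by
    have h := congrArg Polynomial.reverse hP
    rw [Polynomial.reverse_mul_of_domain, reverse_prod_one_sub_X_pow,
      reverse_prod_one_sub_X_pow, hP, hsign] at h
    refine (mul_right_cancel₀ (mul_ne_zero (pow_ne_zero t.card (neg_ne_zero.2 one_ne_zero)) ht)
      ?_).symm
    rw [← h]
    ring
  have hcoeff : ∀ j ≤ m, P.coeff (m - j) = (-1 : ℤ) ^ (a.length - 1) * P.coeff j := by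
    intro j hj
    have h := congrArg (fun Q => Polynomial.coeff Q j) hrev
    simp only [Polynomial.coeff_reverse, hdeg, Polynomial.revAt_le hj] at h
    rw [h, ← Polynomial.coeff_C_mul]
    simp
  have hone : P.coeff 0 = 1 := by
    have h := congrArg (fun Q => Polynomial.coeff Q 0) hP
    simpa only [Polynomial.mul_coeff_zero, coeff_zero_prod_one_sub_X_pow _ _ fun i _ => hr i,
      mul_one, eq_comm] using h
  exact ⟨hcoeff, by simpa [hone] using hcoeff 0 (Nat.zero_le m)⟩
end

section
/- Let a = (a_1,…,a_n) be positive integers and let z = (z_1,…,z_n) ∈ ℂ^n be a critical point of the polynomial map g := p_a + z_1 : ℂ^n → ℂ (all partial derivatives of g vanish at z). Then (a_1a_2⋯a_n) · g(z) = μ(a) · z_1; i.e. the critical value at z equals (μ(a)/(a_1⋯a_n)) · z_1. -/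
open MvPolynomial

/-- The chain type invertible polynomial
`p_a(z_1,…,z_n) = z_1^{a_1} z_2 + ⋯ + z_{n−1}^{a_{n−1}} z_n + z_n^{a_n}` as a
multivariate polynomial over `ℂ` in variables indexed by `Fin n`. -/
noncomputable def chainMv (n : ℕ) (a : Fin n → ℕ) : MvPolynomial (Fin n) ℂ :=
  ∑ k : Fin n,
    X k ^ a k * (if h : (k : ℕ) + 1 < n then X (⟨(k : ℕ) + 1, h⟩ : Fin n) else 1)

theorem chainMu_cons (x : ℕ) (l : List ℕ) :
    chainMu (x :: l) = ((x :: l).prod : ℤ) - chainMu l := by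
  simp only [chainMu, List.length_cons]
  rw [Finset.sum_range_succ']
  simp [pow_succ, Finset.sum_neg_distrib]
  ring

theorem prod_mul_sum_eq_chainMu_mul {n : ℕ} (a : Fin n → ℕ) (m : Fin (n + 1) → ℂ)
    (h : ∀ k : Fin n, (a k : ℂ) * m k.succ = -m k.castSucc) :
    (∏ k, (a k : ℂ)) * ∑ k, m k = (chainMu (List.ofFn a) : ℂ) * m 0 := by
  induction n with
  | zero => simp [chainMu]
  | succ n ih =>
    have ih' := ih (fun k => a k.succ) (fun k => m k.succ) fun k => h k.succ
    have h0 := h 0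
    simp only [Fin.castSucc_zero] at h0
    rw [Fin.prod_univ_succ, Fin.sum_univ_succ, List.ofFn_succ, chainMu_cons, List.prod_cons,
      List.prod_ofFn]
    push_cast
    linear_combination (a 0 : ℂ) * ih' + (chainMu (List.ofFn fun k => a k.succ) : ℂ) * h0

/-- The value at `z` of the `k`-th monomial of `chainMv n a`. -/
noncomputable def chainTerm (n : ℕ) (a : Fin n → ℕ) (z : Fin n → ℂ) (k : Fin n) : ℂ :=
  z k ^ a k * (if h : (k : ℕ) + 1 < n then z ⟨(k : ℕ) + 1, h⟩ else 1)

theorem eval_chainMv (n : ℕ) (a : Fin n → ℕ) (z : Fin n → ℂ) :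
    eval z (chainMv n a) = ∑ k, chainTerm n a z k := by
  simp only [chainMv, chainTerm, map_sum, map_mul, map_pow, eval_X]
  refine Finset.sum_congr rfl fun k _ => ?_
  split_ifs <;> simp

theorem mul_natCast_mul_pow_sub_one (x : ℂ) (m : ℕ) : x * (m * x ^ (m - 1)) = m * x ^ m := by
  cases m with
  | zero => simp
  | succ m => simp [pow_succ]; ring

theorem mul_eval_pderiv_chainMv (n : ℕ) (a : Fin n → ℕ) (z : Fin n → ℂ) (k : Fin n) :
    z k * eval z (pderiv k (chainMv n a)) =
      ∑ j, ((if j = k then (a k : ℂ) * chainTerm n a z k else 0) +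
        if (j : ℕ) + 1 = k then chainTerm n a z j else 0) := by
  simp only [chainMv, map_sum, Finset.mul_sum]
  refine Finset.sum_congr rfl fun j _ => ?_
  rw [pderiv_mul, pderiv_pow, pderiv_X]
  by_cases hj : j = k
  · subst hj
    have e := mul_natCast_mul_pow_sub_one (z j) (a j)
    by_cases h : (j : ℕ) + 1 < n
    · have hne : (⟨(j : ℕ) + 1, h⟩ : Fin n) ≠ j := by simp [Fin.ext_iff]
      simp [chainTerm, h, pderiv_X, hne]
      linear_combination z ⟨(j : ℕ) + 1, h⟩ * e
    · simp [chainTerm, h]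
      linear_combination e
  · by_cases h : (j : ℕ) + 1 < n
    · by_cases hjk : (j : ℕ) + 1 = k
      · simp [chainTerm, hj, hjk, pderiv_X]
        ring
      · have hne : (⟨(j : ℕ) + 1, h⟩ : Fin n) ≠ k := by simpa [Fin.ext_iff] using hjk
        simp [h, hj, hjk, pderiv_X, hne]
    · have hjk : (j : ℕ) + 1 ≠ k := by omega
      simp [h, hj, hjk]

/-- If `z ∈ ℂⁿ` is a critical point of the Morsification `g = p_a + z_1` (all
partial derivatives of `g` vanish at `z`), then
`(a_1⋯a_n) ⋅ g(z) = μ(a) ⋅ z_1`, i.e. the critical value at `z` equals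
`(μ(a)/(a_1⋯a_n)) ⋅ z_1`. -/
theorem stmt14 (n : ℕ) (hn : 0 < n) (a : Fin n → ℕ) (hpos : ∀ k, 0 < a k)
    (z : Fin n → ℂ)
    (hcrit : ∀ k : Fin n,
      eval z (pderiv k (chainMv n a + X (⟨0, hn⟩ : Fin n))) = 0) :
    (∏ k : Fin n, (a k : ℂ)) * eval z (chainMv n a + X (⟨0, hn⟩ : Fin n)) =
      (chainMu (List.ofFn a) : ℂ) * z ⟨0, hn⟩ := by
  obtain ⟨n, rfl⟩ : ∃ m, n = m + 1 := ⟨n - 1, by omega⟩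
  have key := prod_mul_sum_eq_chainMu_mul a (Fin.cons (z 0) (chainTerm (n + 1) a z)) ?_
  · rw [Fin.sum_univ_succ] at key
    simp only [Fin.cons_zero, Fin.cons_succ] at key
    simp only [map_add, eval_chainMv, eval_X, Fin.mk_zero]
    rw [add_comm (∑ k, _)]
    exact key
  · intro k
    have hk := congrArg (z k * ·) (hcrit k)
    simp only [map_add, mul_add, mul_eval_pderiv_chainMv, Finset.sum_add_distrib,
      Finset.sum_ite_eq', Finset.mem_univ, if_true, mul_zero, Fin.mk_zero] at hk
    induction k using Fin.cases with
    | zero =>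
      simp [pderiv_X] at hk
      simpa using eq_neg_of_add_eq_zero_left hk
    | succ i =>
      have hi : ∀ j : Fin (n + 1), (j : ℕ) + 1 = (i.succ : Fin (n + 1)) ↔ j = i.castSucc := by
        intro j; simp [Fin.ext_iff]
      simp only [hi, Finset.sum_ite_eq', Finset.mem_univ, if_true] at hk
      rw [pderiv_X_of_ne (Fin.succ_ne_zero i).symm, map_zero, mul_zero, add_zero] at hk
      rw [← Fin.succ_castSucc]
      simp only [Fin.cons_succ]
      linear_combination hk
end
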